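/- arXiv:2510.24458 — 2 statements merged into one kernel-verified Lean document; each statement's English description precedes it below -/
import Mathlib

section
/- Fix an edge index e. For every connected s in the open set {s ∈ ℝ^m : s_e > 0 on a connected spanning edge set}, the congestion φ is differentiable in the coordinate s_e, and its partial derivative equals ∂φ(s)/∂s_e = − w_e · (a_eᵀ L_s^† d)², which is nonpositive. Equivalently, writing Δ_e(s) = a_eᵀ x(s) for the voltage difference across edge e, one has ∂φ(s)/∂s_e = −w_e Δ_e(s)². -/
open Matrix MeasureTheory BigOperators

noncomputable section

/-- `A` is a signed incidence matrix: each row is `e_i - e_j` for some `i ≠ j`. -/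
def isIncidence (n m : ℕ) (A : Matrix (Fin m) (Fin n) ℝ) : Prop :=
  ∀ e : Fin m, ∃ i j : Fin n, i ≠ j ∧
    A e = fun k => (if k = i then (1 : ℝ) else 0) - (if k = j then (1 : ℝ) else 0)

/-- The matrix `1 1ᵀ / n`, with all entries equal to `1/n`. -/
def onesMat (n : ℕ) : Matrix (Fin n) (Fin n) ℝ := fun _ _ => (1 : ℝ) / n

/-- The switched Laplacian `L_s = Aᵀ diag(w ∘ s) A`. -/
def Lap (n m : ℕ) (A : Matrix (Fin m) (Fin n) ℝ) (w s : Fin m → ℝ) :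
    Matrix (Fin n) (Fin n) ℝ :=
  Aᵀ * Matrix.diagonal (fun e => w e * s e) * A

/-- The Moore–Penrose pseudoinverse of a connected Laplacian:
`L† = (L + 1 1ᵀ/n)⁻¹ - 1 1ᵀ/n`. -/
def Lpinv (n m : ℕ) (A : Matrix (Fin m) (Fin n) ℝ) (w s : Fin m → ℝ) :
    Matrix (Fin n) (Fin n) ℝ :=
  (Lap n m A w s + onesMat n)⁻¹ - onesMat n

/-- Connectivity, encoded as: the kernel of the Laplacian is exactly `span(1)`. -/
def kerIsOnes (n : ℕ) (L : Matrix (Fin n) (Fin n) ℝ) : Prop :=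
  ∀ y : Fin n → ℝ, L.mulVec y = 0 ↔ ∃ c : ℝ, y = fun _ => c

/-- The relaxed congestion `φ(s) = dᵀ L_s† d`. -/
def phi (n m : ℕ) (A : Matrix (Fin m) (Fin n) ℝ) (w s : Fin m → ℝ) (d : Fin n → ℝ) : ℝ :=
  d ⬝ᵥ (Lpinv n m A w s).mulVec d

section Calculus

attribute [local instance] Matrix.linftyOpNormedRing Matrix.linftyOpNormedAlgebra

/-- Derivative of a bilinear form in the inverse of an affine matrix function. -/
theorem hasDerivAt_dotProduct_inv_mulVec {ι : Type*} [Fintype ι] [DecidableEq ι]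
    (M N : Matrix ι ι ℝ) (hM : IsUnit M) (u v : ι → ℝ) (t₀ : ℝ) :
    HasDerivAt (fun t : ℝ => u ⬝ᵥ (M + (t - t₀) • N)⁻¹ *ᵥ v)
      (-(u ⬝ᵥ (M⁻¹ * N * M⁻¹) *ᵥ v)) t₀ := by
  obtain ⟨U, rfl⟩ := hM
  have haff : HasDerivAt (fun t : ℝ => (U : Matrix ι ι ℝ) + (t - t₀) • N) N t₀ := by
    exact ((((hasDerivAt_id t₀).sub_const t₀).smul_const N).const_add
      (U : Matrix ι ι ℝ)).congr_deriv (one_smul ℝ N)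
  have hinv : HasFDerivAt Ring.inverse
      (-ContinuousLinearMap.mulLeftRight ℝ (Matrix ι ι ℝ) ↑U⁻¹ ↑U⁻¹)
      ((U : Matrix ι ι ℝ) + (t₀ - t₀) • N) := by
    simpa using hasFDerivAt_ringInverse (𝕜 := ℝ) U
  let ℓ : Matrix ι ι ℝ →ₗ[ℝ] ℝ :=
    { toFun := fun X => u ⬝ᵥ X *ᵥ v
      map_add' := fun X Y => by rw [Matrix.add_mulVec, dotProduct_add]
      map_smul' := fun c X => by rw [Matrix.smul_mulVec, dotProduct_smul, RingHom.id_apply] }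
  have h := ℓ.toContinuousLinearMap.hasFDerivAt.comp_hasDerivAt t₀
    (hinv.comp_hasDerivAt t₀ haff)
  simp only [Function.comp_def, ← Matrix.nonsing_inv_eq_ringInverse] at h
  refine h.congr_deriv ?_
  change u ⬝ᵥ (-((↑U⁻¹ : Matrix ι ι ℝ) * N * (↑U⁻¹ : Matrix ι ι ℝ))) *ᵥ v = _
  rw [Matrix.neg_mulVec, dotProduct_neg, Matrix.coe_units_inv]

end Calculus

theorem onesMat_mulVec (n : ℕ) (v : Fin n → ℝ) :
    onesMat n *ᵥ v = fun _ => (1 : ℝ) / n * ∑ i, v i := by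
  ext i
  simp [onesMat, Matrix.mulVec, dotProduct, Finset.mul_sum]

theorem Lap_isSymm (n m : ℕ) (A : Matrix (Fin m) (Fin n) ℝ) (w s : Fin m → ℝ) :
    (Lap n m A w s).IsSymm := by
  simp [Matrix.IsSymm, Lap, Matrix.transpose_mul, Matrix.mul_assoc]

theorem isUnit_Lap_add_onesMat (n m : ℕ) (hn : n ≠ 0) (A : Matrix (Fin m) (Fin n) ℝ)
    (w s : Fin m → ℝ) (hconn : kerIsOnes n (Lap n m A w s)) :
    IsUnit (Lap n m A w s + onesMat n) := by
  have hn' : (n : ℝ) ≠ 0 := Nat.cast_ne_zero.mpr hn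
  rw [← Matrix.mulVec_injective_iff_isUnit]
  refine (injective_iff_map_eq_zero (Lap n m A w s + onesMat n).mulVecLin).mpr fun v hv => ?_
  rw [Matrix.mulVecLin_apply, Matrix.add_mulVec, onesMat_mulVec] at hv
  have hL1 : Lap n m A w s *ᵥ (fun _ => 1) = 0 := (hconn _).mpr ⟨1, rfl⟩
  have hsum : ∑ i, v i = 0 := by
    have h := congrArg (fun y => (fun _ => (1 : ℝ)) ⬝ᵥ y) hv
    simp only [dotProduct_add, dotProduct_zero] at h
    rw [Matrix.dotProduct_mulVec, ← Matrix.mulVec_transpose, (Lap_isSymm n m A w s).eq, hL1,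
      zero_dotProduct, zero_add] at h
    simpa [dotProduct, hn'] using h
  obtain ⟨c, rfl⟩ := (hconn v).mp (by
    rw [hsum, mul_zero] at hv
    exact (add_zero (Lap n m A w s *ᵥ v)).symm.trans hv)
  have hc : c = 0 := by simpa [hn'] using hsum
  exact funext fun _ => hc

theorem Lap_update (n m : ℕ) (A : Matrix (Fin m) (Fin n) ℝ) (w s : Fin m → ℝ) (e : Fin m)
    (t : ℝ) :
    Lap n m A w (Function.update s e t) =
      Lap n m A w s + (t - s e) • (w e • Matrix.vecMulVec (A e) (A e)) := by
  ext i j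
  rw [Matrix.add_apply, Lap, Lap, Matrix.mul_apply, Matrix.mul_apply]
  simp only [Matrix.mul_diagonal, Matrix.transpose_apply, Matrix.smul_apply, Matrix.vecMulVec_apply, smul_eq_mul]
  rw [← sub_eq_iff_eq_add', ← Finset.sum_sub_distrib, Finset.sum_eq_single e]
  · rw [Function.update_self]
    ring
  · intro f _ hf
    rw [Function.update_of_ne hf, sub_self]
  · simp

/-- Congestion gradient.
For a fixed edge `e` and any connected `s` with nonnegative entries, the congestion
`φ` is differentiable in the coordinate `s_e` with
`∂φ(s)/∂s_e = −w_e (a_eᵀ L_s† d)² ≤ 0`. -/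
theorem congestion_partial_derivative
    (n m : ℕ) (hn : 2 ≤ n) (hm : 1 ≤ m)
    (A : Matrix (Fin m) (Fin n) ℝ) (hA : isIncidence n m A)
    (w : Fin m → ℝ) (hw : ∀ e, 0 < w e)
    (d : Fin n → ℝ) (hd : ∑ i, d i = 0)
    (e : Fin m) (s : Fin m → ℝ) (hs : ∀ f, 0 ≤ s f)
    (hconn : kerIsOnes n (Lap n m A w s)) :
    HasDerivAt (fun t : ℝ => phi n m A w (Function.update s e t) d)
      (-(w e * (A e ⬝ᵥ (Lpinv n m A w s).mulVec d) ^ 2)) (s e) ∧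
    -(w e * (A e ⬝ᵥ (Lpinv n m A w s).mulVec d) ^ 2) ≤ 0 := by
  have hM := isUnit_Lap_add_onesMat n m (by omega) A w s hconn
  set M := Lap n m A w s + onesMat n with hMdef
  have hsymm : (M⁻¹)ᵀ = M⁻¹ := by
    rw [Matrix.transpose_nonsing_inv, hMdef, Matrix.transpose_add, (Lap_isSymm n m A w s).eq]
    rfl
  have hvolt : Lpinv n m A w s *ᵥ d = M⁻¹ *ᵥ d := by
    rw [Lpinv, Matrix.sub_mulVec, onesMat_mulVec, hd, mul_zero]
    exact sub_zero _
  rw [hvolt]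
  refine ⟨?_, neg_nonpos.mpr (mul_nonneg (hw e).le (sq_nonneg _))⟩
  have h := (hasDerivAt_dotProduct_inv_mulVec M (w e • Matrix.vecMulVec (A e) (A e)) hM d d
    (s e)).sub_const (d ⬝ᵥ onesMat n *ᵥ d)
  have hphi : (fun t : ℝ => phi n m A w (Function.update s e t) d) = fun t =>
      d ⬝ᵥ (M + (t - s e) • (w e • Matrix.vecMulVec (A e) (A e)))⁻¹ *ᵥ d -
        d ⬝ᵥ onesMat n *ᵥ d := by
    funext t
    rw [phi, Lpinv, Matrix.sub_mulVec, dotProduct_sub, Lap_update, hMdef, add_right_comm]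
  rw [hphi]
  refine h.congr_deriv ?_
  rw [← Matrix.mulVec_mulVec, ← Matrix.mulVec_mulVec, Matrix.dotProduct_mulVec,
    ← Matrix.mulVec_transpose, hsymm, Matrix.smul_mulVec, Matrix.vecMulVec_mulVec,
    dotProduct_smul, dotProduct_smul, dotProduct_comm (M⁻¹ *ᵥ d) (A e)]
  simp only [smul_eq_mul, MulOpposite.smul_eq_mul_unop, MulOpposite.unop_op]
  ring
end
end

section
/- (Convexity of the relaxed congestion.) Let T ⊆ {1,…,m} be a set of edges whose graph is connected and spanning, and let D_T = {s ∈ [0,1]^m : s_e = 1 for all e ∈ T}. Then for every s ∈ D_T the matrix L_s + 1 1ᵀ/n is positive definite, and the function s ↦ dᵀ (L_s + 1 1ᵀ/n)^{-1} d − (dᵀ1)²/n = φ(s) is convex on the convex set D_T. -/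
open Matrix MeasureTheory BigOperators

noncomputable section

theorem Matrix.PosDef.two_mul_dotProduct_sub_le {ι : Type*} [Fintype ι] [DecidableEq ι]
    {M : Matrix ι ι ℝ} (hM : M.PosDef) (d x : ι → ℝ) :
    2 * (d ⬝ᵥ x) - x ⬝ᵥ M *ᵥ x ≤ d ⬝ᵥ M⁻¹ *ᵥ d := by
  set y := M⁻¹ *ᵥ d with hy
  have hMy : M *ᵥ y = d := by
    rw [hy, mulVec_mulVec, mul_nonsing_inv _ ((isUnit_iff_isUnit_det M).1 hM.isUnit), one_mulVec]
  have hsymm : y ⬝ᵥ M *ᵥ x = d ⬝ᵥ x := by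
    have hT : Mᵀ = M := by simpa [conjTranspose] using hM.isHermitian.eq
    rw [dotProduct_mulVec, ← mulVec_transpose, hT, hMy]
  have hnonneg : 0 ≤ (x - y) ⬝ᵥ M *ᵥ (x - y) := by
    simpa using hM.posSemidef.dotProduct_mulVec_nonneg (x - y)
  rw [mulVec_sub, hMy, sub_dotProduct, dotProduct_sub, dotProduct_sub, hsymm,
    dotProduct_comm x d, dotProduct_comm y d] at hnonneg
  linarith

theorem Matrix.PosDef.dotProduct_inv_mulVec_eq {ι : Type*} [Fintype ι] [DecidableEq ι]
    {M : Matrix ι ι ℝ} (hM : M.PosDef) (d : ι → ℝ) :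
    d ⬝ᵥ M⁻¹ *ᵥ d = 2 * (d ⬝ᵥ M⁻¹ *ᵥ d) - (M⁻¹ *ᵥ d) ⬝ᵥ M *ᵥ (M⁻¹ *ᵥ d) := by
  have hMy : M *ᵥ (M⁻¹ *ᵥ d) = d := by
    rw [mulVec_mulVec, mul_nonsing_inv _ ((isUnit_iff_isUnit_det M).1 hM.isUnit), one_mulVec]
  rw [hMy, dotProduct_comm _ d]
  ring

/-- A function of the form `s ↦ dᵀ (M s)⁻¹ d` is convex wherever `M` is positive definite and its
quadratic form is affine in `s`. -/
theorem convexOn_dotProduct_inv_mulVec {ι E : Type*} [Fintype ι] [DecidableEq ι]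
    [AddCommGroup E] [Module ℝ E] {D : Set E} (hD : Convex ℝ D) {M : E → Matrix ι ι ℝ}
    (hM : ∀ s ∈ D, (M s).PosDef)
    (hlin : ∀ s t : E, ∀ a b : ℝ, a + b = 1 → ∀ x : ι → ℝ,
      x ⬝ᵥ M (a • s + b • t) *ᵥ x = a * (x ⬝ᵥ M s *ᵥ x) + b * (x ⬝ᵥ M t *ᵥ x))
    (d : ι → ℝ) : ConvexOn ℝ D (fun s => d ⬝ᵥ (M s)⁻¹ *ᵥ d) := by
  refine ⟨hD, fun s hs t ht a b ha hb hab => ?_⟩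
  have hst := hM _ (hD hs ht ha hb hab)
  simp only [smul_eq_mul]
  rw [hst.dotProduct_inv_mulVec_eq d]
  set x := (M (a • s + b • t))⁻¹ *ᵥ d
  rw [hlin s t a b hab x]
  have h1 := mul_le_mul_of_nonneg_left ((hM s hs).two_mul_dotProduct_sub_le d x) ha
  have h2 := mul_le_mul_of_nonneg_left ((hM t ht).two_mul_dotProduct_sub_le d x) hb
  have h3 : 2 * (d ⬝ᵥ x) = a * (2 * (d ⬝ᵥ x)) + b * (2 * (d ⬝ᵥ x)) := by
    rw [← add_mul, hab, one_mul]
  linarith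

theorem Lap_mulVec (n m : ℕ) (A : Matrix (Fin m) (Fin n) ℝ) (w s : Fin m → ℝ) (x : Fin n → ℝ) :
    Lap n m A w s *ᵥ x = Aᵀ *ᵥ fun e => w e * s e * (A *ᵥ x) e := by
  rw [Lap, ← mulVec_mulVec, ← mulVec_mulVec]
  congr 1
  ext e
  rw [mulVec_diagonal]

theorem dotProduct_Lap_add_onesMat_mulVec (n m : ℕ) (A : Matrix (Fin m) (Fin n) ℝ)
    (w s : Fin m → ℝ) (x : Fin n → ℝ) :
    x ⬝ᵥ (Lap n m A w s + onesMat n) *ᵥ x =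
      ∑ e, w e * s e * (A *ᵥ x) e ^ 2 + (∑ i, x i) ^ 2 / n := by
  rw [add_mulVec, dotProduct_add, Lap_mulVec, dotProduct_mulVec, vecMul_transpose]
  congr 1
  · exact Finset.sum_congr rfl fun e _ => by ring
  · simp only [dotProduct, mulVec, onesMat, ← Finset.mul_sum, ← Finset.sum_mul]
    ring

theorem isHermitian_Lap_add_onesMat (n m : ℕ) (A : Matrix (Fin m) (Fin n) ℝ) (w s : Fin m → ℝ) :
    (Lap n m A w s + onesMat n).IsHermitian := by
  refine IsHermitian.add ?_ (by ext; simp [onesMat])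
  rw [Lap, IsHermitian, conjTranspose_eq_transpose_of_trivial]
  simp [Matrix.mul_assoc]

theorem posDef_Lap_add_onesMat {n m : ℕ} (hn : n ≠ 0) {A : Matrix (Fin m) (Fin n) ℝ}
    {w s : Fin m → ℝ} (hw : ∀ e, 0 < w e) (hs : ∀ e, 0 ≤ s e) {T : Finset (Fin m)}
    (hsT : ∀ e ∈ T, 0 < s e)
    (hT : kerIsOnes n (Lap n m A w (fun e => if e ∈ T then 1 else 0))) :
    (Lap n m A w s + onesMat n).PosDef := by
  refine PosDef.of_dotProduct_mulVec_pos (isHermitian_Lap_add_onesMat n m A w s) fun x hx => ?_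
  rw [star_trivial, dotProduct_Lap_add_onesMat_mulVec]
  have hterm : ∀ e ∈ Finset.univ, 0 ≤ w e * s e * (A *ᵥ x) e ^ 2 := fun e _ =>
    mul_nonneg (mul_nonneg (hw e).le (hs e)) (sq_nonneg _)
  have hsum := Finset.sum_nonneg hterm
  have hones : 0 ≤ (∑ i, x i) ^ 2 / (n : ℝ) := by positivity
  refine (add_nonneg hsum hones).lt_of_ne' fun h0 => hx ?_
  rw [add_eq_zero_iff_of_nonneg hsum hones, Finset.sum_eq_zero_iff_of_nonneg hterm] at h0
  obtain ⟨hedge, hmean⟩ := h0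
  have hn' : (n : ℝ) ≠ 0 := Nat.cast_ne_zero.2 hn
  obtain ⟨c, rfl⟩ := (hT x).1 <| by
    rw [Lap_mulVec]
    convert mulVec_zero Aᵀ using 2
    ext e
    by_cases he : e ∈ T
    · simpa [he, (hw e).ne', (hsT e he).ne'] using hedge e (Finset.mem_univ e)
    · simp [he]
  have hc : c = 0 := by simpa [hn'] using hmean
  ext
  simp [hc]

/-- Convexity of the relaxed congestion.
If `T` is a connected spanning set of edges and
`D_T = {s ∈ [0,1]^m : s_e = 1 ∀ e ∈ T}`, then for every `s ∈ D_T` the matrix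
`L_s + 1 1ᵀ/n` is positive definite, and
`s ↦ dᵀ (L_s + 1 1ᵀ/n)⁻¹ d − (dᵀ1)²/n  (= φ(s))` is convex on the convex set `D_T`. -/
theorem congestion_convex
    (n m : ℕ) (hn : 2 ≤ n) (hm : 1 ≤ m)
    (A : Matrix (Fin m) (Fin n) ℝ) (hA : isIncidence n m A)
    (w : Fin m → ℝ) (hw : ∀ e, 0 < w e)
    (d : Fin n → ℝ) (hd : ∑ i, d i = 0)
    (T : Finset (Fin m))
    (hTconn : kerIsOnes n (Lap n m A w (fun e => if e ∈ T then 1 else 0))) :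
    (∀ s ∈ {s : Fin m → ℝ | (∀ e, 0 ≤ s e ∧ s e ≤ 1) ∧ ∀ e ∈ T, s e = 1},
      (Lap n m A w s + onesMat n).PosDef) ∧
    ConvexOn ℝ {s : Fin m → ℝ | (∀ e, 0 ≤ s e ∧ s e ≤ 1) ∧ ∀ e ∈ T, s e = 1}
      (fun s => d ⬝ᵥ ((Lap n m A w s + onesMat n)⁻¹).mulVec d - (∑ i, d i) ^ 2 / n) := by
  have hpos : ∀ s ∈ {s : Fin m → ℝ | (∀ e, 0 ≤ s e ∧ s e ≤ 1) ∧ ∀ e ∈ T, s e = 1},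
      (Lap n m A w s + onesMat n).PosDef := fun s hs =>
    posDef_Lap_add_onesMat (by omega) hw (fun e => (hs.1 e).1)
      (fun e he => by simp [hs.2 e he]) hTconn
  have hconv : Convex ℝ {s : Fin m → ℝ | (∀ e, 0 ≤ s e ∧ s e ≤ 1) ∧ ∀ e ∈ T, s e = 1} := by
    intro s hs t ht a b ha hb hab
    refine ⟨fun e => convex_Icc (0 : ℝ) 1 (hs.1 e) (ht.1 e) ha hb hab, fun e he => ?_⟩
    simp [hs.2 e he, ht.2 e he, hab]
  refine ⟨hpos, ConvexOn.sub (convexOn_dotProduct_inv_mulVec hconv hpos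
    (fun s t a b hab x => ?_) d) (concaveOn_const _ hconv)⟩
  simp only [dotProduct_Lap_add_onesMat_mulVec, Pi.add_apply, Pi.smul_apply, smul_eq_mul,
    mul_add, add_mul, Finset.sum_add_distrib, Finset.mul_sum]
  rw [add_add_add_comm, ← add_mul, hab, one_mul]
  congr 2 <;> exact Finset.sum_congr rfl fun e _ => by ring
end
end
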